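/- Let P be a centrally symmetric simplicial d-polytope. Then the total number of faces of P, including the empty face but excluding P itself, is at least 3^d; that is, 1 + Σ_{j=0}^{d−1} f_j(P) ≥ 3^d. (This is Kalai's 3^d-conjecture for cs simplicial polytopes.) -/

import Mathlib

open Set

/-- A polytope: the convex hull of a finite set of points. -/
def IsPolytope {E : Type*} [AddCommGroup E] [Module ℝ E] (P : Set E) : Prop :=
  ∃ V : Finset E, P = convexHull ℝ (V : Set E)

/-- A (nonempty, proper) exposed face of `P`. -/
def IsProperFace {E : Type*} [AddCommGroup E] [Module ℝ E] [TopologicalSpace E]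
    (P F : Set E) : Prop :=
  F.Nonempty ∧ F ≠ P ∧ IsExposed ℝ P F

/-- A polytope is simplicial if the vertices (extreme points) of each proper face are
affinely independent. -/
def IsSimplicial {d : ℕ} (P : Set (Fin d → ℝ)) : Prop :=
  ∀ F : Set (Fin d → ℝ), IsProperFace P F →
    AffineIndependent ℝ (fun x : F.extremePoints ℝ => (x : Fin d → ℝ))

/-- The number of `j`-dimensional proper faces of `P`. -/
noncomputable def faceCount {d : ℕ} (P : Set (Fin d → ℝ)) (j : ℕ) : ℕ :=
  Set.ncard {F : Set (Fin d → ℝ) |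
    IsProperFace P F ∧ Module.finrank ℝ (affineSpan ℝ F).direction = j}

/-- `f_{j-1}(P)` with the convention `f_{-1} = 1`. -/
noncomputable def fm {d : ℕ} (P : Set (Fin d → ℝ)) (j : ℕ) : ℤ :=
  if j = 0 then 1 else (faceCount P (j - 1) : ℤ)

/-- The `h`-numbers of a simplicial `d`-polytope:
`h_i = ∑_{j=0}^{i} (-1)^{i-j} C(d-j, i-j) f_{j-1}`. -/
noncomputable def hP {d : ℕ} (P : Set (Fin d → ℝ)) (i : ℕ) : ℤ :=
  ∑ j ∈ Finset.range (i + 1),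
    (-1 : ℤ) ^ (i - j) * ((d - j).choose (i - j)) * fm P j

theorem Matrix.trace_nonneg_of_mul_self {n : Type*} [Fintype n] [DecidableEq n]
    {E : Matrix n n ℝ} (h : E * E = E) : 0 ≤ E.trace := by
  have he : IsIdempotentElem (Matrix.toLin' E) := by
    rw [IsIdempotentElem, Module.End.mul_eq_comp, ← Matrix.toLin'_mul, h]
  rw [← Matrix.trace_toLin'_eq, (LinearMap.IsIdempotentElem.isProj_range _ he).trace]
  exact Nat.cast_nonneg _

theorem Matrix.sum_diag_le_card {ι : Type*} [Fintype ι] [DecidableEq ι]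
    {Q : Matrix ι ι ℝ} (hQ : Q * Q = 1)
    (r : ι → ℕ) (hr : ∀ i j, Q i j ≠ 0 → r i = r j) (k : ℕ) :
    ∑ i with r i = k, Q i i ≤ ((Finset.univ.filter fun i => r i = k).card : ℝ) := by
  set D : Matrix ι ι ℝ := Matrix.diagonal fun i => if r i = k then 1 else 0 with hD
  have hDD : D * D = D := by
    rw [hD, Matrix.diagonal_mul_diagonal]
    congr 1
    ext i
    split_ifs <;> simp
  have hDQ : D * Q = Q * D := by
    ext i j
    rw [hD, Matrix.diagonal_mul, Matrix.mul_diagonal]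
    by_cases h : Q i j = 0
    · simp [h]
    · rw [hr i j h, mul_comm]
  set E : Matrix ι ι ℝ := (1 / 2 : ℝ) • (D * (1 - Q)) with hE
  have hEE : E * E = E := by
    have h1 : (1 - Q) * D = D * (1 - Q) := by
      rw [Matrix.sub_mul, Matrix.mul_sub, Matrix.one_mul, Matrix.mul_one, hDQ]
    have h2 : (1 - Q) * (1 - Q) = (2 : ℝ) • (1 - Q) := by
      rw [Matrix.mul_sub, Matrix.sub_mul, Matrix.sub_mul, hQ, Matrix.one_mul, Matrix.mul_one,
        Matrix.one_mul, two_smul]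
      abel
    rw [hE, Matrix.smul_mul, Matrix.mul_smul, Matrix.mul_assoc, ← Matrix.mul_assoc (1 - Q) D,
      h1, Matrix.mul_assoc D (1 - Q), h2, ← Matrix.mul_assoc, hDD, Matrix.mul_smul,
      smul_smul, smul_smul]
    norm_num
  have h := Matrix.trace_nonneg_of_mul_self hEE
  rw [hE, Matrix.trace_smul, Matrix.trace] at h
  simp only [Matrix.diag_apply, hD, Matrix.diagonal_mul, Matrix.sub_apply, Matrix.one_apply_eq,
    ite_mul, one_mul, zero_mul, smul_eq_mul, ← Finset.sum_filter, Finset.sum_sub_distrib,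
    Finset.sum_const, nsmul_eq_mul, mul_one] at h
  linarith

/-- The combinatorial data of a complete simplicial fan in `ℝ ^ d` which is symmetric about the
origin, together with a shelling order of its maximal cones. The cone `F i` has ray generators
`c v`, with dual basis `e i v`, and `R i` is its restriction face. -/
structure SymmetricShelledFan (d : ℕ) (V ι : Type*) [DecidableEq V] where
  c : V → Fin d → ℝ
  neg : V → V
  neg_neg : ∀ v, neg (neg v) = v
  c_neg : ∀ v k, c (neg v) k = -c v k
  F : ι → Finset V
  R : ι → Finset V
  val : ι → ℝ
  e : ι → V → Fin d → ℝ
  R_subset : ∀ i, R i ⊆ F i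
  card_F : ∀ i, (F i).card = d
  dual : ∀ i, ∀ v ∈ F i, ∀ u ∈ F i, ∑ k, e i v k * c u k = if u = v then 1 else 0
  dual' : ∀ i k l, ∑ v ∈ F i, c v k * e i v l = if k = l then 1 else 0
  val_lt : ∀ i j, R i ⊆ F j → j ≠ i → val j < val i
  cover : ∀ i, ∀ G ⊆ F i, ∃ j, R j ⊆ G ∧ G ⊆ F j
  symm : ∀ i, ∃ j, ∀ v, v ∈ F j ↔ neg v ∈ F i
  neg_notMem : ∀ i, ∀ v ∈ F i, neg v ∉ F i

namespace SymmetricShelledFan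

open MvPolynomial

variable {d : ℕ} {V ι : Type*} [DecidableEq V] (S : SymmetricShelledFan d V ι)

/-- Restriction of a polynomial to the coordinate subspace spanned by `F i`. -/
noncomputable def res (i : ι) : MvPolynomial V ℝ →ₐ[ℝ] MvPolynomial V ℝ :=
  aeval fun v => if v ∈ S.F i then X v else 0

/-- The coordinate functions of the ambient space, as linear forms in the face ring. -/
noncomputable def theta [Fintype V] : MvPolynomial (Fin d) ℝ →ₐ[ℝ] MvPolynomial V ℝ :=
  aeval fun k => ∑ v, C (S.c v k) * X v

/-- The inverse of `theta` on the cone `F i`. -/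
noncomputable def rho (i : ι) : MvPolynomial V ℝ →ₐ[ℝ] MvPolynomial (Fin d) ℝ :=
  aeval fun v => if v ∈ S.F i then ∑ k, C (S.e i v k) * X k else 0

/-- The squarefree monomial of the restriction face `R i`. -/
noncomputable def b (i : ι) : MvPolynomial V ℝ := ∏ v ∈ S.R i, X v

theorem weight_one_eq_degree {σ : Type*} (m : σ →₀ ℕ) :
    Finsupp.weight (1 : σ → ℕ) m = m.degree :=
  (DFunLike.congr_fun Finsupp.degree_eq_weight_one m).symm

theorem coeff_res (i : ι) (m : V →₀ ℕ) (f : MvPolynomial V ℝ) :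
    coeff m (S.res i f) = if m.support ⊆ S.F i then coeff m f else 0 := by
  classical
  induction f using MvPolynomial.induction_on' with
  | monomial u a =>
    have h : S.res i (monomial u a) = if u.support ⊆ S.F i then monomial u a else 0 := by
      rw [res, aeval_monomial]
      split_ifs with hu
      · rw [monomial_eq]
        congr 1
        exact Finsupp.prod_congr fun v hv => by rw [if_pos (hu hv)]
      · obtain ⟨v, hv, hvF⟩ := Finset.not_subset.mp hu
        rw [Finsupp.prod, Finset.prod_eq_zero hv, mul_zero]
        rw [if_neg hvF, zero_pow (Finsupp.mem_support_iff.mp hv)]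
    rw [h]
    by_cases hum : u = m
    · subst hum
      split_ifs <;> simp
    · split_ifs <;> simp [coeff_monomial, hum]
  | add p q hp hq =>
    rw [map_add, coeff_add, hp, hq, coeff_add]
    split_ifs <;> simp

theorem res_b_of_not_subset {i j : ι} (h : ¬ S.R i ⊆ S.F j) : S.res j (S.b i) = 0 := by
  obtain ⟨v, hv, hvF⟩ := Finset.not_subset.mp h
  rw [b, map_prod]
  exact Finset.prod_eq_zero hv (by simp [res, hvF])

theorem res_b_self (i : ι) : S.res i (S.b i) = S.b i := by
  rw [b, map_prod]
  exact Finset.prod_congr rfl fun v hv => by simp [res, S.R_subset i hv]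

theorem b_ne_zero (i : ι) : S.b i ≠ 0 :=
  Finset.prod_ne_zero_iff.mpr fun v _ => X_ne_zero v

theorem b_eq_monomial (i : ι) :
    S.b i = monomial (∑ v ∈ S.R i, Finsupp.single v 1) (1 : ℝ) := by
  rw [b, monomial_sum_one]; rfl

theorem b_isHomogeneous (i : ι) : (S.b i).IsHomogeneous (S.R i).card := by
  have := IsHomogeneous.prod (S.R i) (fun v => (X v : MvPolynomial V ℝ)) (fun _ => 1)
    (fun v _ => isHomogeneous_X ℝ v)
  simpa [b] using this

theorem rho_res (i : ι) (f : MvPolynomial V ℝ) : S.rho i (S.res i f) = S.rho i f := by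
  have : (S.rho i).comp (S.res i) = S.rho i := by
    refine MvPolynomial.algHom_ext fun v => ?_
    by_cases hv : v ∈ S.F i <;> simp [rho, res, hv]
  exact DFunLike.congr_fun this f

theorem rho_isHomogeneous (i : ι) {f : MvPolynomial V ℝ} {n : ℕ} (hf : f.IsHomogeneous n) :
    (S.rho i f).IsHomogeneous n := by
  have := hf.aeval (n := 1) (fun v => if v ∈ S.F i then ∑ k, C (S.e i v k) * X k else 0)
    (fun v => by
    split_ifs
    · exact IsHomogeneous.sum _ _ _ fun k _ => by
        simpa using (isHomogeneous_C (Fin d) (S.e i v k)).mul (isHomogeneous_X ℝ k)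
    · exact isHomogeneous_zero _ _ _)
  simpa [rho] using this

section Fintype

variable [Fintype V]

theorem theta_isHomogeneous {f : MvPolynomial (Fin d) ℝ} {n : ℕ} (hf : f.IsHomogeneous n) :
    (S.theta f).IsHomogeneous n := by
  have := hf.aeval (n := 1) (fun k => ∑ v, C (S.c v k) * X v) (fun k =>
    IsHomogeneous.sum _ _ _ fun v _ => by
      simpa using (isHomogeneous_C V (S.c v k)).mul (isHomogeneous_X ℝ v))
  simpa [theta] using this

theorem rho_theta (i : ι) (p : MvPolynomial (Fin d) ℝ) : S.rho i (S.theta p) = p := by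
  have : (S.rho i).comp S.theta = AlgHom.id ℝ _ := by
    refine MvPolynomial.algHom_ext fun k => ?_
    have h1 : ∀ v, S.rho i (C (S.c v k) * X v) =
        if v ∈ S.F i then ∑ l, C (S.c v k * S.e i v l) * X l else 0 := by
      intro v
      rw [map_mul, ← algebraMap_eq, AlgHom.commutes]
      simp only [rho, aeval_X]
      split_ifs
      · rw [Finset.mul_sum]
        exact Finset.sum_congr rfl fun l _ => by rw [algebraMap_eq, ← mul_assoc, ← C_mul]
      · simp
    simp only [AlgHom.comp_apply, theta, aeval_X, map_sum, h1, AlgHom.id_apply]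
    rw [← Finset.sum_filter, Finset.sum_comm]
    have h2 : ∀ l, ∑ v with v ∈ S.F i, C (S.c v k * S.e i v l) * X l =
        (C (if k = l then (1 : ℝ) else 0) * X l : MvPolynomial (Fin d) ℝ) := by
      intro l
      rw [← Finset.sum_mul, ← map_sum, Finset.filter_mem_eq_inter, Finset.univ_inter, S.dual']
    simp only [h2]
    rw [Finset.sum_eq_single k]
    · simp
    · intro l _ hl; simp [Ne.symm hl]
    · simp
  exact DFunLike.congr_fun this p

theorem res_theta_rho (i : ι) (f : MvPolynomial V ℝ) :
    S.res i (S.theta (S.rho i f)) = S.res i f := by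
  have : ((S.res i).comp S.theta).comp (S.rho i) = S.res i := by
    refine MvPolynomial.algHom_ext fun v => ?_
    simp only [AlgHom.comp_apply]
    by_cases hv : v ∈ S.F i
    · have h1 : ∀ u, S.res i (X u) = if u ∈ S.F i then (X u : MvPolynomial V ℝ) else 0 := by
        intro u; simp [res]
      have h2 : S.rho i (X v) = ∑ k, C (S.e i v k) * X k := by simp [rho, hv]
      have h3 : ∀ (a : ℝ), S.res i (C a) = C a := fun a => by
        rw [← algebraMap_eq, AlgHom.commutes]
      have h4 : ∀ (a : ℝ), S.theta (C a) = C a := fun a => by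
        rw [← algebraMap_eq, AlgHom.commutes, algebraMap_eq]
      have h5 : ∀ k, S.theta (X k) = ∑ u, C (S.c u k) * X u := fun k => by simp [theta]
      simp only [h2, map_sum, map_mul, h4, h5, h3, h1, mul_ite, mul_zero, if_pos hv]
      simp only [← Finset.sum_filter, Finset.filter_mem_eq_inter, Finset.univ_inter,
        Finset.mul_sum, ← mul_assoc, ← C_mul]
      rw [Finset.sum_comm]
      have h6 : ∀ u ∈ S.F i, ∑ k, C (S.e i v k * S.c u k) * X u =
          (C (if u = v then (1 : ℝ) else 0) * X u : MvPolynomial V ℝ) := by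
        intro u hu
        rw [← Finset.sum_mul, ← map_sum, S.dual i v hv u hu]
      rw [Finset.sum_congr rfl h6, Finset.sum_eq_single v]
      · simp
      · intro u _ hu; simp [hu]
      · exact fun h => absurd hv h
    · simp [rho, res, hv]
  exact DFunLike.congr_fun this f

theorem eq_zero_of_res_eq_zero [Fintype ι] (p : ι → MvPolynomial (Fin d) ℝ)
    (h : ∀ i, S.res i (∑ j, S.theta (p j) * S.b j) = 0) : p = 0 := by
  classical
  by_contra hp
  have hne : (Finset.univ.filter fun i => p i ≠ 0).Nonempty := by
    obtain ⟨i, hi⟩ := Function.ne_iff.mp hp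
    exact ⟨i, by simpa using hi⟩
  obtain ⟨i, hi, hmax⟩ := Finset.exists_max_image _ S.val hne
  have hi0 : p i ≠ 0 := by simpa using hi
  have := h i
  rw [map_sum, Finset.sum_eq_single i] at this
  · rw [map_mul, res_b_self] at this
    have h0 := (mul_eq_zero.mp this).resolve_right (S.b_ne_zero i)
    apply hi0
    rw [← S.rho_theta i (p i), ← S.rho_res, h0, map_zero]
  · intro j _ hj
    by_cases hpj : p j = 0
    · simp [hpj]
    · rw [map_mul, S.res_b_of_not_subset, mul_zero]
      intro hsub
      exact absurd (S.val_lt j i hsub hj.symm) (not_lt.mpr (hmax j (by simpa using hpj)))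
  · simp

theorem exists_expansion [Fintype ι] {n : ℕ} (f : MvPolynomial V ℝ) (hf : f.IsHomogeneous n) :
    ∃ p : ι → MvPolynomial (Fin d) ℝ,
      (∀ i, S.res i f = S.res i (∑ j, S.theta (p j) * S.b j)) ∧
      ∀ i α, coeff α (p i) ≠ 0 → α.degree + (S.R i).card = n := by
  classical
  have key : ∀ U : Finset ι, (∀ j ∉ U, ∀ i ∈ U, S.val i ≤ S.val j) →
      ∀ f : MvPolynomial V ℝ, f.IsHomogeneous n → (∀ j ∉ U, S.res j f = 0) →
      ∃ p : ι → MvPolynomial (Fin d) ℝ,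
      (∀ i, S.res i f = S.res i (∑ j, S.theta (p j) * S.b j)) ∧
      ∀ i α, coeff α (p i) ≠ 0 → α.degree + (S.R i).card = n := by
    intro U
    induction U using Finset.induction_on_max_value S.val with
    | empty => exact fun _ f _ h => ⟨0, fun i => by simp [h i], by simp⟩
    | insert a s ha hmax ih =>
      intro hU f hf hres
      set r : V →₀ ℕ := ∑ v ∈ S.R a, Finsupp.single v 1 with hr
      have hr_apply : ∀ v, r v = if v ∈ S.R a then 1 else 0 := by
        intro v
        simp [hr, Finsupp.finsetSum_apply, Finsupp.single_apply]
      have hr_deg : r.degree = (S.R a).card := by simp [hr]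
      have hb : S.b a = monomial r 1 := S.b_eq_monomial a
      set g := (S.res a f).divMonomial r with hg
      have hmod : (S.res a f).modMonomial r = 0 := by
        ext m
        by_cases hm : r ≤ m
        · rw [coeff_modMonomial_of_le _ hm, coeff_zero]
        rw [coeff_modMonomial_of_not_le _ hm, coeff_zero, coeff_res]
        split_ifs with hmF
        swap
        · rfl
        obtain ⟨j, hRj, hFj⟩ := S.cover a _ hmF
        have hja : j ≠ a := by
          rintro rfl
          apply hm
          intro v
          rw [hr_apply]
          split_ifs with hv
          · exact Nat.one_le_iff_ne_zero.mpr (Finsupp.mem_support_iff.mp (hRj hv))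
          · exact Nat.zero_le _
        have hlt := S.val_lt j a (hRj.trans hmF) hja.symm
        have hjU : j ∉ insert a s := by
          rw [Finset.mem_insert]
          rintro (h | h)
          · exact hja h
          · exact absurd (hmax j h) (not_le.mpr hlt)
        have := congrArg (coeff m) (hres j hjU)
        rwa [coeff_res, if_pos hFj, coeff_zero] at this
      have hfac : S.res a f = S.b a * g := by
        have := divMonomial_add_modMonomial (S.res a f) r
        rw [hmod, add_zero] at this
        rw [hb, ← this]
      have hgres : S.res a g = g := by
        ext m
        rw [coeff_res]
        split_ifs with hm
        · rfl
        · rw [hg, coeff_divMonomial, coeff_res, if_neg]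
          intro h
          apply hm
          intro v hv
          apply h
          rw [Finsupp.mem_support_iff] at hv ⊢
          simp [hv]
      have hcg : ∀ m, coeff m g ≠ 0 → m.degree + (S.R a).card = n := by
        intro m hm
        rw [hg, coeff_divMonomial, coeff_res] at hm
        have h0 : coeff (r + m) f ≠ 0 := fun h => hm (by simp [h])
        have := hf h0
        rw [weight_one_eq_degree] at this
        simp only [map_add] at this
        omega
      have hp : ∀ α, coeff α (S.rho a g) ≠ 0 → α.degree + (S.R a).card = n := by
        by_cases hcard : (S.R a).card ≤ n
        · have hgh : g.IsHomogeneous (n - (S.R a).card) := by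
            intro m hm
            have := hcg m hm
            rw [weight_one_eq_degree]
            omega
          intro α hα
          have := S.rho_isHomogeneous a hgh hα
          rw [weight_one_eq_degree] at this
          omega
        · have hg0 : g = 0 := by
            ext m
            by_contra hm
            have := hcg m hm
            omega
          simp [hg0]
      have hhom : (S.theta (S.rho a g) * S.b a).IsHomogeneous n := by
        by_cases hcard : (S.R a).card ≤ n
        · have h1 : (S.rho a g).IsHomogeneous (n - (S.R a).card) := by
            intro m hm
            have := hp m hm
            rw [weight_one_eq_degree]
            omega
          have := (S.theta_isHomogeneous h1).mul (S.b_isHomogeneous a)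
          rwa [Nat.sub_add_cancel hcard] at this
        · have h0 : S.rho a g = 0 := by
            ext m
            by_contra hm
            have := hp m hm
            omega
          rw [h0, map_zero, zero_mul]
          exact isHomogeneous_zero _ _ _
      have hs : ∀ j ∉ s, ∀ i ∈ s, S.val i ≤ S.val j := by
        intro j hj i hi
        by_cases hja : j = a
        · exact hja ▸ hmax i hi
        · exact hU j (by simp [hja, hj]) i (Finset.mem_insert_of_mem hi)
      obtain ⟨q, hq, hqd⟩ := ih hs (f - S.theta (S.rho a g) * S.b a) (hf.sub hhom) (by
        intro j hj
        rw [map_sub, map_mul]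
        by_cases hja : j = a
        · subst hja
          rw [res_theta_rho, hgres, res_b_self, hfac, mul_comm, sub_self]
        · have hjU : j ∉ insert a s := by simp [hja, hj]
          rw [hres j hjU, S.res_b_of_not_subset, mul_zero, sub_zero]
          intro hsub
          exact absurd (S.val_lt a j hsub hja)
            (not_lt.mpr (hU j hjU a (Finset.mem_insert_self a s))))
      refine ⟨q + Pi.single a (S.rho a g), fun i => ?_, fun i α hα => ?_⟩
      · have h1 : ∑ j, S.theta ((q + Pi.single a (S.rho a g) : ι → _) j) * S.b j =
            ∑ j, S.theta (q j) * S.b j + S.theta (S.rho a g) * S.b a := by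
          simp only [Pi.add_apply, map_add, add_mul, Finset.sum_add_distrib]
          congr 1
          rw [Finset.sum_eq_single a]
          · simp
          · intro j _ hj; simp [hj]
          · simp
        rw [h1, map_add, ← hq i, ← map_add, sub_add_cancel]
      · by_cases hqi : coeff α (q i) = 0
        · by_cases hia : i = a
          · subst hia
            apply hp
            simpa [hqi] using hα
          · simp [hqi, hia] at hα
        · exact hqd i α hqi
  exact key Finset.univ (by simp) f hf (by simp)

end Fintype

section Trace

theorem neg_monomial (α : Fin d →₀ ℕ) :
    aeval (fun k => -X k) (monomial α (1 : ℝ)) =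
      (C ((-1) ^ α.degree) * monomial α 1 : MvPolynomial (Fin d) ℝ) := by
  rw [aeval_monomial, monomial_eq, Finsupp.degree_apply, Finsupp.prod, Finsupp.prod]
  simp only [map_one, one_mul, neg_pow (X _ : MvPolynomial (Fin d) ℝ), Finset.prod_mul_distrib,
    Finset.prod_pow_eq_pow_sum, map_pow, map_neg]

theorem res_rename_neg (f : MvPolynomial V ℝ) (h : ∀ i, S.res i f = 0) (i : ι) :
    S.res i (rename S.neg f) = 0 := by
  obtain ⟨j, hj⟩ := S.symm i
  have : (S.res i).comp (rename S.neg) = (rename S.neg).comp (S.res j) := by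
    refine MvPolynomial.algHom_ext fun v => ?_
    by_cases hv : v ∈ S.F j
    · simp [res, hv, (hj v).mp hv]
    · simp [res, hv, mt (hj v).mpr hv]
  have := DFunLike.congr_fun this f
  simpa [h j] using this

theorem neg_injective : Function.Injective S.neg :=
  Function.Involutive.injective S.neg_neg

/-- Indices of the elements of degree `n` of the basis given by the shelling. -/
noncomputable def shellingIndex [Fintype ι] (n : ℕ) : Finset (Σ _ : ι, Fin d →₀ ℕ) :=
  Finset.univ.sigma fun i =>
    if (S.R i).card ≤ n then Finset.finsuppAntidiag Finset.univ (n - (S.R i).card) else ∅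

theorem mem_shellingIndex [Fintype ι] {n : ℕ} {j : Σ _ : ι, Fin d →₀ ℕ} :
    j ∈ S.shellingIndex n ↔ j.2.degree + (S.R j.1).card = n := by
  rw [shellingIndex, Finset.mem_sigma]
  split_ifs with h
  · simp only [Finset.mem_finsuppAntidiag, Finsupp.degree_eq_sum, Finset.mem_univ, true_and,
      Finset.subset_univ, and_true]
    exact eq_tsub_iff_add_eq_of_le h
  · simp
    omega

variable [Fintype V]

theorem rename_neg_theta (p : MvPolynomial (Fin d) ℝ) :
    rename S.neg (S.theta p) = S.theta (aeval (fun k => -X k) p) := by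
  have : (rename S.neg).comp S.theta = S.theta.comp (aeval fun k => -X k) := by
    refine MvPolynomial.algHom_ext fun k => ?_
    simp only [AlgHom.comp_apply, theta, aeval_X, map_sum, map_mul, rename_C, rename_X, map_neg]
    rw [← Finset.sum_neg_distrib]
    refine Finset.sum_nbij' S.neg S.neg (by simp) (by simp) (fun v _ => S.neg_neg v)
      (fun v _ => S.neg_neg v) fun v _ => ?_
    rw [S.c_neg, C_neg, neg_mul, _root_.neg_neg]
  exact DFunLike.congr_fun this p

variable [Fintype ι]

/-- Exponents of the monomials of degree `n` in the face ring. -/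
noncomputable def faceMonomials (n : ℕ) : Finset (V →₀ ℕ) :=
  open Classical in
  (Finset.finsuppAntidiag Finset.univ n).filter fun m => ∃ i, m.support ⊆ S.F i

theorem mem_faceMonomials {n : ℕ} {m : V →₀ ℕ} :
    m ∈ S.faceMonomials n ↔ m.degree = n ∧ ∃ i, m.support ⊆ S.F i := by
  simp [faceMonomials, Finset.mem_finsuppAntidiag, Finsupp.degree_eq_sum]

/-- The matrix expressing the shelling basis in terms of monomials. -/
noncomputable def shellingMatrix (n : ℕ) : Matrix (S.shellingIndex n) (S.faceMonomials n) ℝ :=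
  fun j m => coeff m.1 (S.theta (monomial j.1.2 1) * S.b j.1.1)

theorem coeff_combination {n : ℕ} (p : ι → MvPolynomial (Fin d) ℝ)
    (hp : ∀ i α, coeff α (p i) ≠ 0 → α.degree + (S.R i).card = n) (m : S.faceMonomials n) :
    coeff m.1 (∑ i, S.theta (p i) * S.b i) =
      ∑ j : S.shellingIndex n, coeff j.1.2 (p j.1.1) * S.shellingMatrix n j m := by
  have h1 : ∀ i, p i = ∑ α ∈ (if (S.R i).card ≤ n then
      Finset.finsuppAntidiag Finset.univ (n - (S.R i).card) else ∅),
        C (coeff α (p i)) * monomial α 1 := by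
    intro i
    conv_lhs => rw [(p i).as_sum]
    simp only [C_mul_monomial, mul_one]
    refine Finset.sum_subset (fun α hα => ?_) fun α _ hα => ?_
    · have := hp i α (mem_support_iff.mp hα)
      have h2 := (S.mem_shellingIndex (n := n) (j := ⟨i, α⟩)).mpr this
      rw [shellingIndex, Finset.mem_sigma] at h2
      exact h2.2
    · rw [notMem_support_iff.mp hα, monomial_zero]
  have h2 : ∀ i, coeff m.1 (S.theta (p i) * S.b i) = ∑ α ∈ (if (S.R i).card ≤ n then
      Finset.finsuppAntidiag Finset.univ (n - (S.R i).card) else ∅),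
        coeff α (p i) * coeff m.1 (S.theta (monomial α 1) * S.b i) := by
    intro i
    conv_lhs => rw [h1 i]
    rw [map_sum, Finset.sum_mul, coeff_sum]
    refine Finset.sum_congr rfl fun α _ => ?_
    rw [map_mul, ← algebraMap_eq, AlgHom.commutes, algebraMap_eq, mul_assoc, coeff_C_mul]
  rw [coeff_sum, Finset.sum_congr rfl fun i _ => h2 i]
  rw [Finset.sum_sigma', ← shellingIndex]
  exact (Finset.sum_coe_sort (S.shellingIndex n) fun j =>
    coeff j.2 (p j.1) * coeff m.1 (S.theta (monomial j.2 1) * S.b j.1)).symm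

theorem combination_isHomogeneous {n : ℕ} (p : ι → MvPolynomial (Fin d) ℝ)
    (hp : ∀ i α, coeff α (p i) ≠ 0 → α.degree + (S.R i).card = n) :
    (∑ i, S.theta (p i) * S.b i).IsHomogeneous n := by
  refine IsHomogeneous.sum _ _ _ fun i _ => ?_
  by_cases hcard : (S.R i).card ≤ n
  · have h1 : (p i).IsHomogeneous (n - (S.R i).card) := by
      intro m hm
      have := hp i m hm
      rw [weight_one_eq_degree]
      omega
    have := (S.theta_isHomogeneous h1).mul (S.b_isHomogeneous i)
    rwa [Nat.sub_add_cancel hcard] at this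
  · have h0 : p i = 0 := by
      ext m
      by_contra hm
      have := hp i m hm
      omega
    rw [h0, map_zero, zero_mul]
    exact isHomogeneous_zero _ _ _

theorem coeff_eq_of_res_eq {n : ℕ} {f g : MvPolynomial V ℝ} (h : ∀ i, S.res i f = S.res i g)
    (m : S.faceMonomials n) : coeff m.1 f = coeff m.1 g := by
  obtain ⟨i, hi⟩ := (S.mem_faceMonomials.mp m.2).2
  have := congrArg (coeff m.1) (h i)
  rwa [coeff_res, coeff_res, if_pos hi, if_pos hi] at this

theorem eq_zero_of_vecMul_eq_zero {n : ℕ} (a : S.shellingIndex n → ℝ)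
    (h : ∀ m, ∑ j, a j * S.shellingMatrix n j m = 0) : a = 0 := by
  classical
  set a' : (Σ _ : ι, Fin d →₀ ℕ) → ℝ := fun j => if hj : j ∈ S.shellingIndex n then a ⟨j, hj⟩ else 0
    with ha'
  set p : ι → MvPolynomial (Fin d) ℝ := fun i => ∑ α ∈ (if (S.R i).card ≤ n then
      Finset.finsuppAntidiag Finset.univ (n - (S.R i).card) else ∅), monomial α (a' ⟨i, α⟩) with hp
  have hcoeff : ∀ i α, coeff α (p i) = a' ⟨i, α⟩ := by
    intro i α
    simp only [hp, coeff_sum, coeff_monomial, Finset.sum_ite_eq']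
    split_ifs with h1 h2 h2
    · rfl
    · have : (⟨i, α⟩ : Σ _ : ι, Fin d →₀ ℕ) ∉ S.shellingIndex n := by
        rw [shellingIndex, Finset.mem_sigma, if_pos h1]
        exact fun h => h2 h.2
      simp [ha', this]
    · simp at h2
    · have : (⟨i, α⟩ : Σ _ : ι, Fin d →₀ ℕ) ∉ S.shellingIndex n := by
        rw [shellingIndex, Finset.mem_sigma, if_neg h1]
        simp
      simp [ha', this]
  have hdeg : ∀ i α, coeff α (p i) ≠ 0 → α.degree + (S.R i).card = n := by
    intro i α h1
    rw [hcoeff] at h1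
    by_contra h2
    apply h1
    simp only [ha']
    rw [dif_neg]
    rw [mem_shellingIndex]
    exact h2
  have hp0 : p = 0 := by
    refine S.eq_zero_of_res_eq_zero p fun i => ?_
    ext m
    rw [coeff_res, coeff_zero]
    split_ifs with hm
    · by_cases hmn : m.degree = n
      · have h1 := S.coeff_combination p hdeg ⟨m, S.mem_faceMonomials.mpr ⟨hmn, i, hm⟩⟩
        rw [h1, ← h ⟨m, S.mem_faceMonomials.mpr ⟨hmn, i, hm⟩⟩]
        refine Finset.sum_congr rfl fun j _ => ?_
        rw [hcoeff]
        simp [ha']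
      · by_contra hne
        have := S.combination_isHomogeneous p hdeg hne
        rw [weight_one_eq_degree] at this
        exact hmn this
    · rfl
  funext j
  have := hcoeff j.1.1 j.1.2
  rw [hp0] at this
  simpa [ha'] using this.symm

theorem exists_shellingMatrix_inverse [DecidableEq ι] (n : ℕ) :
    ∃ D : Matrix (S.faceMonomials n) (S.shellingIndex n) ℝ,
      D * S.shellingMatrix n = 1 ∧ S.shellingMatrix n * D = 1 := by
  classical
  have h : ∀ m : S.faceMonomials n, ∃ a : S.shellingIndex n → ℝ,
      ∀ m', ∑ j, a j * S.shellingMatrix n j m' = (1 : Matrix _ _ ℝ) m m' := by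
    intro m
    have hm := (S.mem_faceMonomials.mp m.2).1
    obtain ⟨p, hp, hpd⟩ := S.exists_expansion (monomial m.1 (1 : ℝ)) (isHomogeneous_monomial 1 hm)
    refine ⟨fun j => coeff j.1.2 (p j.1.1), fun m' => ?_⟩
    rw [← S.coeff_combination p hpd, ← S.coeff_eq_of_res_eq hp, coeff_monomial, Matrix.one_apply]
    simp only [Subtype.ext_iff]
  choose D hD using h
  have h1 : Matrix.of D * S.shellingMatrix n = 1 := by
    ext m m'
    exact hD m m'
  refine ⟨Matrix.of D, h1, ?_⟩
  set M : Matrix (S.shellingIndex n) (S.shellingIndex n) ℝ :=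
    S.shellingMatrix n * Matrix.of D - 1 with hM
  have h2 : M * S.shellingMatrix n = 0 := by
    rw [hM, Matrix.sub_mul, Matrix.one_mul, Matrix.mul_assoc, h1, Matrix.mul_one, sub_self]
  rw [← sub_eq_zero, ← hM]
  ext j j'
  exact congrFun (S.eq_zero_of_vecMul_eq_zero (M j) fun m => congrFun (congrFun h2 j) m) j'

/-- The symmetry acting on the monomials of the face ring. -/
noncomputable def negMonomial (n : ℕ) (m : S.faceMonomials n) : S.faceMonomials n :=
  ⟨Finsupp.mapDomain S.neg m.1, by
    obtain ⟨hd, i, hi⟩ := S.mem_faceMonomials.mp m.2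
    refine S.mem_faceMonomials.mpr ⟨?_, ?_⟩
    · simpa using hd
    · obtain ⟨j, hj⟩ := S.symm i
      refine ⟨j, fun v hv => ?_⟩
      rw [Finsupp.mapDomain_support_of_injective S.neg_injective, Finset.mem_image] at hv
      obtain ⟨u, hu, rfl⟩ := hv
      rw [hj, S.neg_neg]
      exact hi hu⟩

theorem negMonomial_ne {n : ℕ} (hn : n ≠ 0) (m : S.faceMonomials n) : S.negMonomial n m ≠ m := by
  intro h
  obtain ⟨hd, i, hi⟩ := S.mem_faceMonomials.mp m.2
  have hm : m.1 ≠ 0 := by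
    intro h0
    rw [h0, map_zero] at hd
    exact hn hd.symm
  obtain ⟨v, hv⟩ := Finsupp.support_nonempty_iff.mpr hm
  have h1 : Finsupp.mapDomain S.neg m.1 = m.1 := congrArg Subtype.val h
  have h2 : S.neg v ∈ m.1.support := by
    rw [← h1, Finsupp.mapDomain_support_of_injective S.neg_injective]
    exact Finset.mem_image_of_mem _ hv
  exact S.neg_notMem i v (hi hv) (hi h2)

theorem coeff_rename_neg {n : ℕ} (f : MvPolynomial V ℝ) (m : S.faceMonomials n) :
    coeff m.1 (rename S.neg f) = coeff (S.negMonomial n m).1 f := by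
  have h : m.1 = Finsupp.mapDomain S.neg (S.negMonomial n m).1 := by
    rw [negMonomial, ← Finsupp.mapDomain_comp]
    have : S.neg ∘ S.neg = id := funext S.neg_neg
    rw [this, Finsupp.mapDomain_id]
  conv_lhs => rw [h]
  exact coeff_rename_mapDomain S.neg S.neg_injective f _

/-- The action of the symmetry on the face ring modulo its linear system of parameters: an
involutive matrix, preserving degrees, with prescribed graded trace. -/
theorem exists_involution [DecidableEq ι] [Nonempty ι] : ∃ Q : Matrix ι ι ℝ, Q * Q = 1 ∧
    (∀ i j, Q i j ≠ 0 → (S.R i).card = (S.R j).card) ∧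
    ∀ n, ∑ j ∈ S.shellingIndex n, (-1) ^ j.2.degree * Q j.1 j.1 = if n = 0 then 1 else 0 := by
  classical
  have hren : ∀ i, (rename S.neg (S.b i)).IsHomogeneous (S.R i).card := fun i =>
    (S.b_isHomogeneous i).rename_isHomogeneous
  choose q hq hqd using fun i => S.exists_expansion _ (hren i)
  refine ⟨Matrix.of fun i j => constantCoeff (q i j), ?_, ?_, ?_⟩
  · have h : ∀ i, (fun k => ∑ j, aeval (fun l => -X l) (q i j) * q j k - if i = k then 1 else 0) =
        (0 : ι → MvPolynomial (Fin d) ℝ) := by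
      intro i
      refine S.eq_zero_of_res_eq_zero _ fun l => ?_
      have h1 : ∑ k, S.theta (∑ j, aeval (fun l => -X l) (q i j) * q j k - if i = k then 1 else 0) *
          S.b k = ∑ j, S.theta (aeval (fun l => -X l) (q i j)) * ∑ k, S.theta (q j k) * S.b k -
            S.b i := by
        simp only [map_sub, map_sum, map_mul, sub_mul, Finset.sum_sub_distrib, Finset.sum_mul,
          Finset.mul_sum, mul_assoc]
        rw [Finset.sum_comm]
        congr 1
        rw [Finset.sum_eq_single i]
        · simp
        · intro k _ hk; simp [Ne.symm hk]
        · simp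
      have h2 : S.b i = rename S.neg (rename S.neg (S.b i)) := by
        rw [rename_rename]
        have : S.neg ∘ S.neg = id := funext S.neg_neg
        rw [this, rename_id_apply]
      have h3 := S.res_rename_neg (rename S.neg (S.b i) - ∑ j, S.theta (q i j) * S.b j)
        (fun i' => by rw [map_sub, hq i i', sub_self]) l
      rw [map_sub, ← h2, map_sub] at h3
      simp only [map_sum, map_mul, rename_neg_theta] at h3
      rw [h1, map_sub, sub_eq_zero.mp h3]
      simp only [map_sum, map_mul]
      rw [sub_eq_zero]
      refine Finset.sum_congr rfl fun j _ => ?_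
      rw [hq j l]
      simp only [map_sum, map_mul]
    ext i k
    have h1 := congrArg constantCoeff (congrFun (h i) k)
    simp only [map_sub, map_sum, map_mul, Pi.zero_apply, map_zero] at h1
    have h2 : ∀ p : MvPolynomial (Fin d) ℝ,
        constantCoeff (aeval (fun l => -X l : Fin d → MvPolynomial (Fin d) ℝ) p) =
          constantCoeff p := by
      intro p
      induction p using MvPolynomial.induction_on with
      | C a => simp
      | add p q hp hq => rw [map_add, map_add, map_add, hp, hq]
      | mul_X p k hp => simp
    simp only [h2] at h1
    simp only [Matrix.mul_apply, Matrix.of_apply]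
    rw [sub_eq_zero.mp h1, Matrix.one_apply]
    split_ifs <;> simp
  · intro i j hij
    have := hqd i j 0 hij
    simpa using this.symm
  · intro n
    obtain ⟨D, hDC, hCD⟩ := S.exists_shellingMatrix_inverse n
    set P : Matrix (S.shellingIndex n) (S.shellingIndex n) ℝ := fun j k =>
      coeff k.1.2 (C ((-1) ^ j.1.2.degree) * monomial j.1.2 1 * q j.1.1 k.1.1) with hP
    have hPC : P * S.shellingMatrix n =
        fun j m => S.shellingMatrix n j (S.negMonomial n m) := by
      ext j m
      have hd : ∀ i α, coeff α (C ((-1) ^ j.1.2.degree) * monomial j.1.2 1 * q j.1.1 i) ≠ 0 →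
          α.degree + (S.R i).card = n := by
        intro i α h
        rw [mul_assoc, coeff_C_mul, coeff_monomial_mul'] at h
        by_cases hle : j.1.2 ≤ α
        · rw [if_pos hle, one_mul] at h
          have h1 := hqd j.1.1 i (α - j.1.2) (fun h0 => h (by rw [h0, mul_zero]))
          have h2 := S.mem_shellingIndex.mp j.2
          have h3 : α = j.1.2 + (α - j.1.2) := (add_tsub_cancel_of_le hle).symm
          rw [h3, map_add]
          omega
        · rw [if_neg hle, mul_zero] at h
          exact absurd rfl h
      have h1 := S.coeff_combination
        (fun i => C ((-1) ^ j.1.2.degree) * monomial j.1.2 1 * q j.1.1 i) hd m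
      rw [Matrix.mul_apply]
      refine h1.symm.trans ?_
      rw [shellingMatrix, ← coeff_rename_neg]
      refine S.coeff_eq_of_res_eq (fun i => ?_) m
      rw [map_mul, rename_neg_theta, neg_monomial, map_mul (S.res i), hq j.1.1 i, ← map_mul,
        Finset.mul_sum]
      simp only [map_mul, mul_assoc]
    have htr : Matrix.trace P = if n = 0 then 1 else 0 := by
      have h1 : Matrix.trace P = Matrix.trace (D * (P * S.shellingMatrix n)) := by
        rw [Matrix.trace_mul_comm, Matrix.mul_assoc, hCD, Matrix.mul_one]
      have h2 : ∀ m, (D * (P * S.shellingMatrix n)) m m =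
          if m = S.negMonomial n m then 1 else 0 := by
        intro m
        rw [← Matrix.one_apply, ← hDC, hPC]
        rfl
      rw [h1, Matrix.trace]
      simp only [Matrix.diag_apply, h2]
      split_ifs with hn
      · subst hn
        have h3 : S.faceMonomials 0 = {0} := by
          ext m
          rw [mem_faceMonomials, Finset.mem_singleton, Finsupp.degree_eq_zero_iff]
          refine ⟨fun h => h.1, ?_⟩
          rintro rfl
          exact ⟨rfl, Classical.arbitrary ι, by simp⟩
        have hsub : ∀ m m' : S.faceMonomials 0, m = m' := by
          intro m m'
          have h4 := Finset.mem_singleton.mp (h3.le m.2)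
          have h5 := Finset.mem_singleton.mp (h3.le m'.2)
          exact Subtype.ext (h4.trans h5.symm)
        rw [Finset.sum_congr rfl fun m _ => if_pos (hsub _ _)]
        simp [h3]
      · exact Finset.sum_eq_zero fun m _ => if_neg (S.negMonomial_ne hn m).symm
    rw [← htr, Matrix.trace]
    rw [← Finset.sum_coe_sort]
    refine Finset.sum_congr rfl fun j _ => ?_
    rw [Matrix.diag_apply, hP]
    simp only
    rw [mul_assoc, coeff_C_mul, coeff_monomial_mul', if_pos le_rfl, tsub_self, one_mul]
    rfl

end Trace


section Count

theorem hilbertSeries_mul (hd : 0 < d) :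
    (PowerSeries.mk fun n => (-1 : ℝ) ^ n *
      ((Finset.finsuppAntidiag (Finset.univ : Finset (Fin d)) n).card : ℝ)) *
      (1 + PowerSeries.X) ^ d = 1 := by
  obtain ⟨e, rfl⟩ : ∃ e, d = e + 1 := ⟨d - 1, by omega⟩
  have h := congrArg PowerSeries.evalNegHom
    (PowerSeries.mk_add_choose_mul_one_sub_pow_eq_one ℝ e)
  rw [map_mul, map_pow, map_sub, map_one, PowerSeries.evalNegHom_X, sub_neg_eq_add] at h
  refine Eq.trans ?_ h
  congr 1
  ext n
  rw [PowerSeries.evalNegHom, PowerSeries.coeff_rescale, PowerSeries.coeff_mk,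
    PowerSeries.coeff_mk, Finset.card_finsuppAntidiag_nat_eq_choose, Finset.card_univ,
    Fintype.card_fin, show e + 1 + n - 1 = e + n by omega, Nat.choose_symm_add]

theorem three_pow_le_sum [Fintype V] [Fintype ι] [Nonempty ι] (hd : 0 < d) :
    3 ^ d ≤ ∑ i, 2 ^ (d - (S.R i).card) := by
  classical
  obtain ⟨Q, hQ, hdeg, htr⟩ := S.exists_involution
  set T : PowerSeries ℝ := ∑ i, PowerSeries.C (Q i i) * PowerSeries.X ^ (S.R i).card with hT
  set U : PowerSeries ℝ := PowerSeries.mk fun n => (-1 : ℝ) ^ n *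
      ((Finset.finsuppAntidiag (Finset.univ : Finset (Fin d)) n).card : ℝ) with hU
  have hUd : U * (1 + PowerSeries.X) ^ d = 1 := hilbertSeries_mul hd
  have hTU : T * U = 1 := by
    ext n
    rw [PowerSeries.coeff_one, ← htr n, shellingIndex, Finset.sum_sigma, hT, Finset.sum_mul,
      map_sum]
    refine Finset.sum_congr rfl fun i _ => ?_
    rw [mul_assoc, PowerSeries.coeff_C_mul, PowerSeries.coeff_X_pow_mul']
    split_ifs with h
    · dsimp only
      rw [hU, PowerSeries.coeff_mk, ← Finset.sum_mul, mul_comm]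
      congr 1
      have h1 : ∀ α ∈ Finset.finsuppAntidiag (Finset.univ : Finset (Fin d)) (n - (S.R i).card),
          (-1 : ℝ) ^ α.degree = (-1) ^ (n - (S.R i).card) := by
        intro α hα
        rw [Finsupp.degree_eq_sum]
        congr 1
        exact (Finset.mem_finsuppAntidiag.mp hα).1
      rw [Finset.sum_congr rfl h1, Finset.sum_const, nsmul_eq_mul, mul_comm]
    · simp
  have hTd : T = (1 + PowerSeries.X) ^ d := by
    calc T = T * (U * (1 + PowerSeries.X) ^ d) := by rw [hUd, mul_one]
      _ = (1 + PowerSeries.X) ^ d := by rw [← mul_assoc, hTU, one_mul]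
  have hcoeff : ∀ k, ∑ i with (S.R i).card = k, Q i i = (d.choose k : ℝ) := by
    intro k
    have h1 := congrArg (PowerSeries.coeff k) hTd
    have h2 : ((1 + PowerSeries.X) ^ d : PowerSeries ℝ) =
        (((1 + Polynomial.X) ^ d : Polynomial ℝ) : PowerSeries ℝ) := by simp
    rw [h2, Polynomial.coeff_coe, Polynomial.coeff_one_add_X_pow, hT, map_sum] at h1
    rw [← h1, Finset.sum_filter]
    refine Finset.sum_congr rfl fun i _ => ?_
    rw [PowerSeries.coeff_C_mul, PowerSeries.coeff_X_pow]
    by_cases h : (S.R i).card = k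
    · simp [h]
    · simp [h, Ne.symm h]
  have hle : ∀ k, d.choose k ≤ (Finset.univ.filter fun i => (S.R i).card = k).card := by
    intro k
    have := Matrix.sum_diag_le_card hQ (fun i => (S.R i).card) hdeg k
    rw [hcoeff k] at this
    exact_mod_cast this
  have hmaps : ∀ i ∈ (Finset.univ : Finset ι), (S.R i).card ∈ Finset.range (d + 1) := by
    intro i _
    rw [Finset.mem_range, Nat.lt_succ_iff]
    exact (Finset.card_le_card (S.R_subset i)).trans (S.card_F i).le
  have h3 : 3 ^ d = ∑ k ∈ Finset.range (d + 1), 2 ^ (d - k) * d.choose k := by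
    have := add_pow 1 2 d
    simpa using this
  rw [h3, ← Finset.sum_fiberwise_of_maps_to hmaps]
  refine Finset.sum_le_sum fun k _ => ?_
  have h4 : ∀ i ∈ Finset.univ.filter (fun i => (S.R i).card = k),
      2 ^ (d - (S.R i).card) = 2 ^ (d - k) := by
    intro i hi
    rw [(Finset.mem_filter.mp hi).2]
  rw [Finset.sum_congr rfl h4, Finset.sum_const, smul_eq_mul, mul_comm]
  exact Nat.mul_le_mul_right _ (hle k)

theorem three_pow_le_card [Fintype V] [Fintype ι] [Nonempty ι] (hd : 0 < d)
    (𝒢 : Finset (Finset V)) (h𝒢 : ∀ i, ∀ G ⊆ S.F i, G ∈ 𝒢) : 3 ^ d ≤ 𝒢.card := by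
  classical
  have hcard : ∀ i, (Finset.Icc (S.R i) (S.F i)).card = 2 ^ (d - (S.R i).card) := by
    intro i
    rw [Finset.card_Icc_finset (S.R_subset i), S.card_F]
  have hdisj : (Set.univ : Set ι).PairwiseDisjoint fun i => Finset.Icc (S.R i) (S.F i) := by
    intro i _ j _ hij
    rw [Function.onFun, Finset.disjoint_left]
    intro G hi hj
    rw [Finset.mem_Icc] at hi hj
    exact lt_asymm (S.val_lt i j (hi.1.trans hj.2) hij.symm) (S.val_lt j i (hj.1.trans hi.2) hij)
  calc 3 ^ d ≤ ∑ i, 2 ^ (d - (S.R i).card) := S.three_pow_le_sum hd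
    _ = ∑ i, (Finset.Icc (S.R i) (S.F i)).card := Finset.sum_congr rfl fun i _ => (hcard i).symm
    _ = (Finset.univ.biUnion fun i => Finset.Icc (S.R i) (S.F i)).card :=
        (Finset.card_biUnion fun i _ j _ h => hdisj (Set.mem_univ i) (Set.mem_univ j) h).symm
    _ ≤ 𝒢.card := Finset.card_le_card fun G hG => by
        obtain ⟨i, _, hi⟩ := Finset.mem_biUnion.mp hG
        exact h𝒢 i G (Finset.mem_Icc.mp hi).2

end Count


end SymmetricShelledFan

/-- A centrally symmetric finite spanning set of vectors in `ℝ ^ d`, indexed by `V`, such that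
the vectors on every supporting hyperplane `a = 1` are linearly independent. -/
structure SymmetricSimplicialConfiguration (d : ℕ) (V : Type*) where
  c : V → Fin d → ℝ
  neg : V → V
  neg_neg : ∀ v, neg (neg v) = v
  c_neg : ∀ v, c (neg v) = -c v
  span_eq_top : Submodule.span ℝ (range c) = ⊤
  linearIndependent : ∀ a : Module.Dual ℝ (Fin d → ℝ), (∀ u, a (c u) ≤ 1) →
    LinearIndependent ℝ fun v : {v // a (c v) = 1} => c v

namespace SymmetricSimplicialConfiguration

variable {d : ℕ} {V : Type*} (S : SymmetricSimplicialConfiguration d V)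

/-- `S.IsFace a G` says that `a = 1` is a supporting hyperplane of the configuration and that
`G` is the set of indices of the vectors on it. -/
def IsFace (a : Module.Dual ℝ (Fin d → ℝ)) (G : Finset V) : Prop :=
  (∀ u, a (S.c u) ≤ 1) ∧ ∀ u, u ∈ G ↔ a (S.c u) = 1

variable {S}

theorem IsFace.linearIndependent {a : Module.Dual ℝ (Fin d → ℝ)} {G : Finset V}
    (h : S.IsFace a G) : LinearIndependent ℝ fun v : G => S.c v :=
  (S.linearIndependent a h.1).comp (fun v : G => (⟨v, (h.2 v).mp v.2⟩ : {v // a (S.c v) = 1}))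
    fun _ _ huv => Subtype.ext (congrArg (fun x => x.1) huv)

theorem IsFace.card_le {a : Module.Dual ℝ (Fin d → ℝ)} {G : Finset V}
    (h : S.IsFace a G) : G.card ≤ d := by
  simpa using h.linearIndependent.fintype_card_le_finrank

theorem IsFace.exists_dual [DecidableEq V] {a : Module.Dual ℝ (Fin d → ℝ)} {F : Finset V}
    (h : S.IsFace a F) (hF : F.card = d) :
    ∃ e : V → Module.Dual ℝ (Fin d → ℝ),
      (∀ v ∈ F, ∀ u ∈ F, e v (S.c u) = if u = v then 1 else 0) ∧
      ∀ x, ∑ v ∈ F, e v x • S.c v = x := by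
  classical
  set B := basisOfLinearIndependentOfCardEqFinrank' _ h.linearIndependent (by simp [hF]) with hB
  have hBc : ∀ v, B v = S.c v := fun v => by rw [hB]; simp
  refine ⟨fun v => if hv : v ∈ F then B.coord ⟨v, hv⟩ else 0, fun v hv u hu => ?_, fun x => ?_⟩
  · simp only [dif_pos hv]
    rw [← hBc ⟨u, hu⟩, Module.Basis.coord_apply, Module.Basis.repr_self, Finsupp.single_apply]
    simp
  · rw [← Finset.sum_coe_sort]
    conv_rhs => rw [← B.sum_repr x]
    exact Finset.sum_congr rfl fun v _ => by simp [hBc]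

theorem exists_isFace_of_le [Fintype V] {a : Module.Dual ℝ (Fin d → ℝ)}
    (h : ∀ u, a (S.c u) ≤ 1) : ∃ G, S.IsFace a G := by
  classical
  exact ⟨Finset.univ.filter fun u => a (S.c u) = 1, h, by simp⟩

theorem exists_apply_neg (e : Module.Dual ℝ (Fin d → ℝ)) (he : e ≠ 0) : ∃ u, e (S.c u) < 0 := by
  by_contra! h
  apply he
  refine LinearMap.ext_on S.span_eq_top ?_
  rintro _ ⟨u, rfl⟩
  refine le_antisymm ?_ (h u)
  have := h (S.neg u)
  rw [S.c_neg, map_neg] at this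
  simpa using this

theorem exists_pivot [Fintype V] {a e : Module.Dual ℝ (Fin d → ℝ)} (ha : ∀ u, a (S.c u) ≤ 1)
    (hae : ∀ u, a (S.c u) = 1 → 0 ≤ e (S.c u)) (he : e ≠ 0) :
    ∃ μ : ℝ, 0 < μ ∧ (∀ u, (a - μ • e) (S.c u) ≤ 1) ∧
      ∃ u, e (S.c u) < 0 ∧ (a - μ • e) (S.c u) = 1 := by
  classical
  obtain ⟨u₁, hu₁⟩ := S.exists_apply_neg e he
  obtain ⟨u₀, hu₀, hmin⟩ := Finset.exists_min_image
    (Finset.univ.filter fun u => e (S.c u) < 0) (fun u => (1 - a (S.c u)) / (-e (S.c u)))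
    ⟨u₁, by simpa using hu₁⟩
  have h₀ : e (S.c u₀) < 0 := by simpa using hu₀
  have hlt : a (S.c u₀) < 1 := lt_of_le_of_ne (ha u₀) fun h => absurd (hae u₀ h) (not_le.mpr h₀)
  set μ := (1 - a (S.c u₀)) / (-e (S.c u₀)) with hμ
  have hμ0 : 0 < μ := div_pos (by linarith) (by linarith)
  refine ⟨μ, hμ0, fun u => ?_, u₀, h₀, ?_⟩
  · rw [LinearMap.sub_apply, LinearMap.smul_apply, smul_eq_mul]
    by_cases hu : e (S.c u) < 0
    · have := hmin u (by simpa using hu)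
      rw [le_div_iff₀ (by linarith)] at this
      linarith
    · have := mul_nonneg hμ0.le (not_lt.mp hu)
      linarith [ha u]
  · rw [LinearMap.sub_apply, LinearMap.smul_apply, smul_eq_mul]
    have := div_mul_cancel₀ (1 - a (S.c u₀)) (neg_ne_zero.mpr h₀.ne)
    rw [← hμ] at this
    linarith

theorem exists_facet [Fintype V] : ∃ a F, S.IsFace a F ∧ F.card = d := by
  classical
  obtain ⟨F, hF, hmax⟩ := Finset.exists_max_image
    (Finset.univ.filter fun F : Finset V => ∃ a, S.IsFace a F) Finset.card (by
      obtain ⟨G, hG⟩ := S.exists_isFace_of_le (a := 0) (by simp)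
      exact ⟨G, by simpa using ⟨_, hG⟩⟩)
  obtain ⟨a, ha⟩ : ∃ a, S.IsFace a F := by simpa using hF
  refine ⟨a, F, ha, le_antisymm ha.card_le ?_⟩
  by_contra! hlt
  have hspan : Submodule.span ℝ (range fun v : F => S.c v) < ⊤ := by
    refine lt_top_iff_ne_top.mpr fun h => ?_
    have := finrank_span_eq_card ha.linearIndependent
    rw [h, finrank_top] at this
    simp at this
    omega
  obtain ⟨e, he0, he⟩ := Submodule.exists_le_ker_of_lt_top _ hspan
  have heF : ∀ v ∈ F, e (S.c v) = 0 := fun v hv =>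
    he (Submodule.subset_span ⟨⟨v, hv⟩, rfl⟩)
  obtain ⟨μ, -, hle, u, hu, hu1⟩ := S.exists_pivot ha.1
    (fun v hv => (heF v ((ha.2 v).mpr hv)).ge) he0
  obtain ⟨G, hG⟩ := S.exists_isFace_of_le hle
  have hFG : insert u F ⊆ G := by
    refine Finset.insert_subset ((hG.2 u).mpr hu1) fun v hv => (hG.2 v).mpr ?_
    rw [LinearMap.sub_apply, LinearMap.smul_apply, heF v hv, smul_zero, sub_zero]
    exact (ha.2 v).mp hv
  have huF : u ∉ F := fun h => hu.ne (heF u h)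
  have := Finset.card_le_card hFG
  rw [Finset.card_insert_of_notMem huF] at this
  have := hmax G (by simpa using ⟨_, hG⟩)
  omega

theorem IsFace.exists_of_subset [Fintype V] {a : Module.Dual ℝ (Fin d → ℝ)} {F G : Finset V}
    (h : S.IsFace a F) (hF : F.card = d) (hG : G ⊆ F) : ∃ l, S.IsFace l G := by
  classical
  obtain ⟨e, he, -⟩ := h.exists_dual hF
  by_cases hGF : G = F
  · exact ⟨a, hGF ▸ h⟩
  obtain ⟨v₀, hv₀, hv₀G⟩ := Finset.exists_of_ssubset (Finset.ssubset_iff_subset_ne.mpr ⟨hG, hGF⟩)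
  set ε : Module.Dual ℝ (Fin d → ℝ) := ∑ v ∈ F \ G, e v with hε
  have hεF : ∀ u ∈ F, ε (S.c u) = if u ∈ G then 0 else 1 := by
    intro u hu
    rw [hε, LinearMap.sum_apply,
      Finset.sum_congr rfl fun v hv => he v (Finset.mem_sdiff.mp hv).1 u hu,
      Finset.sum_ite_eq]
    by_cases huG : u ∈ G <;> simp [huG, hu]
  have hεne : ε ≠ 0 := by
    intro h0
    have := hεF v₀ hv₀
    rw [h0, if_neg hv₀G] at this
    simp at this
  obtain ⟨μ, hμ, hle, -⟩ := S.exists_pivot h.1 (e := ε) (fun u hu => by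
    rw [hεF u ((h.2 u).mpr hu)]
    split_ifs <;> norm_num) hεne
  have hval : ∀ u, (a - (μ / 2) • ε) (S.c u) =
      (a (S.c u) + (a - μ • ε) (S.c u)) / 2 := by
    intro u
    simp only [LinearMap.sub_apply, LinearMap.smul_apply, smul_eq_mul]
    ring
  refine ⟨a - (μ / 2) • ε, fun u => ?_, fun u => ?_⟩
  · rw [hval]
    linarith [h.1 u, hle u]
  · rw [hval]
    constructor
    · intro hu
      have h1 := (h.2 u).mp (hG hu)
      have h2 := hεF u (hG hu)
      rw [if_pos hu] at h2
      simp only [LinearMap.sub_apply, LinearMap.smul_apply, h1, h2]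
      norm_num
    · intro hu
      have h1 : a (S.c u) = 1 := by linarith [h.1 u, hle u]
      have h2 : (a - μ • ε) (S.c u) = 1 := by linarith
      by_contra huG
      have h3 := hεF u ((h.2 u).mpr h1)
      rw [if_neg huG] at h3
      simp only [LinearMap.sub_apply, LinearMap.smul_apply, h1, h3, smul_eq_mul] at h2
      linarith

theorem IsFace.exists_neighbor [Fintype V] [DecidableEq V] {a e : Module.Dual ℝ (Fin d → ℝ)}
    {F : Finset V} (h : S.IsFace a F) (hF : F.card = d) {v : V} (hv : v ∈ F)
    (he : ∀ u ∈ F, e (S.c u) = if u = v then 1 else 0) :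
    ∃ (μ : ℝ) (F' : Finset V), 0 < μ ∧ S.IsFace (a - μ • e) F' ∧ F'.card = d ∧ F.erase v ⊆ F' := by
  have he0 : e ≠ 0 := by
    intro h0
    have := he v hv
    rw [h0, if_pos rfl] at this
    simp at this
  obtain ⟨μ, hμ, hle, u, hu, hu1⟩ := S.exists_pivot h.1 (e := e) (fun u hu => by
    rw [he u ((h.2 u).mpr hu)]
    split_ifs <;> norm_num) he0
  obtain ⟨F', hF'⟩ := S.exists_isFace_of_le hle
  have hsub : F.erase v ⊆ F' := by
    intro w hw
    rw [Finset.mem_erase] at hw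
    rw [hF'.2, LinearMap.sub_apply, LinearMap.smul_apply, he w hw.2, if_neg hw.1, smul_zero,
      sub_zero]
    exact (h.2 w).mp hw.2
  refine ⟨μ, F', hμ, hF', le_antisymm hF'.card_le ?_, hsub⟩
  have huF : u ∉ F.erase v := by
    intro h1
    have := he u (Finset.mem_of_mem_erase h1)
    rw [this] at hu
    split_ifs at hu <;> norm_num at hu
  have h2 := Finset.card_le_card (Finset.insert_subset ((hF'.2 u).mpr hu1) hsub)
  rw [Finset.card_insert_of_notMem huF, Finset.card_erase_of_mem hv] at h2
  have : 0 < F.card := Finset.card_pos.mpr ⟨v, hv⟩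
  omega

variable (S)

theorem exists_symmetricShelledFan [Fintype V] [DecidableEq V] :
    ∃ T : SymmetricShelledFan d V {F : Finset V // ∃ a, S.IsFace a F ∧ F.card = d},
      ∀ i, T.F i = i.1 := by
  classical
  choose a ha hcard using fun i : {F : Finset V // ∃ a, S.IsFace a F ∧ F.card = d} => i.2
  choose e he hsum using fun i => (ha i).exists_dual (hcard i)
  obtain ⟨w, hw⟩ := Module.Dual.exists_forall_ne_zero_of_forall_exists
    (fun p : Σ i : {F : Finset V // ∃ a, S.IsFace a F ∧ F.card = d}, i.1 => e p.1 p.2)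
    (fun p => ⟨S.c p.2, by rw [he p.1 p.2 p.2.2 p.2 p.2.2]; simp⟩)
  have hw0 : ∀ i, ∀ v ∈ i.1, e i v w ≠ 0 := fun i v hv => hw ⟨i, v, hv⟩
  have hcoord : ∀ (l : Module.Dual ℝ (Fin d → ℝ)) x, ∑ k, l (Pi.single k 1) * x k = l x := by
    intro l x
    conv_rhs => rw [pi_eq_sum_univ' x, map_sum]
    refine Finset.sum_congr rfl fun k _ => ?_
    rw [map_smul, smul_eq_mul, mul_comm]
  have hexp : ∀ i (l : Module.Dual ℝ (Fin d → ℝ)), l w = ∑ v ∈ i.1, e i v w * l (S.c v) := by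
    intro i l
    conv_lhs => rw [← hsum i w, map_sum]
    simp
  refine ⟨{ c := S.c, neg := S.neg, neg_neg := S.neg_neg
            c_neg := fun v k => by rw [S.c_neg]; rfl
            F := fun i => i.1
            R := fun i => i.1.filter fun v => e i v w < 0
            val := fun i => a i w
            e := fun i v k => e i v (Pi.single k 1)
            R_subset := fun i => Finset.filter_subset _ _
            card_F := hcard
            dual := fun i v hv u hu => by rw [hcoord, he i v hv u hu]
            dual' := fun i k l => ?_
            val_lt := fun i j hij hne => ?_
            cover := fun i G hG => ?_
            symm := fun i => ?_
            neg_notMem := fun i v hv hv' => ?_ }, fun i => rfl⟩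
  · have := congrFun (hsum i (Pi.single l 1)) k
    rw [Finset.sum_apply] at this
    simp only [Pi.smul_apply, smul_eq_mul, Pi.single_apply] at this
    rw [← this]
    exact Finset.sum_congr rfl fun v _ => mul_comm _ _
  · rw [hexp i (a j), hexp i (a i)]
    obtain ⟨v, hv, hvj⟩ : ∃ v ∈ i.1, v ∉ j.1 := by
      by_contra! h
      exact hne (Subtype.ext (Finset.eq_of_subset_of_card_le h (by rw [hcard, hcard])).symm)
    have hle : ∀ u ∈ i.1, e i u w * a j (S.c u) ≤ e i u w * a i (S.c u) := by
      intro u hu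
      rw [((ha i).2 u).mp hu]
      by_cases h : e i u w < 0
      · rw [((ha j).2 u).mp (hij (Finset.mem_filter.mpr ⟨hu, h⟩))]
      · exact mul_le_mul_of_nonneg_left ((ha j).1 u) (not_lt.mp h)
    refine Finset.sum_lt_sum hle ⟨v, hv, ?_⟩
    rw [((ha i).2 v).mp hv]
    have h1 : ¬ e i v w < 0 := fun h => hvj (hij (Finset.mem_filter.mpr ⟨hv, h⟩))
    have h2 : 0 < e i v w := lt_of_le_of_ne (not_lt.mp h1) (hw0 i v hv).symm
    exact mul_lt_mul_of_pos_left
      (lt_of_le_of_ne ((ha j).1 v) fun h => hvj (((ha j).2 v).mpr h)) h2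
  · obtain ⟨j, hj, hmax⟩ := Finset.exists_max_image
      (Finset.univ.filter fun j : {F : Finset V // ∃ a, S.IsFace a F ∧ F.card = d} => G ⊆ j.1)
      (fun j => a j w) ⟨i, by simpa using hG⟩
    have hGj : G ⊆ j.1 := by simpa using hj
    refine ⟨j, fun v hv => ?_, hGj⟩
    by_contra hvG
    obtain ⟨hvj, hneg⟩ := Finset.mem_filter.mp hv
    obtain ⟨μ, F', hμ, hF', hF'c, hsub⟩ := (ha j).exists_neighbor (hcard j) hvj
      (fun u hu => he j v hvj u hu)
    set j' : {F : Finset V // ∃ a, S.IsFace a F ∧ F.card = d} := ⟨F', _, hF', hF'c⟩ with hj'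
    have h1 := hmax j' (by
      simp only [Finset.mem_filter, Finset.mem_univ, true_and]
      exact fun u hu => hsub (Finset.mem_erase.mpr ⟨fun h => hvG (h ▸ hu), hGj hu⟩))
    have h2 : a j' w = (a j - μ • e j v) w := by
      rw [hexp j' (a j'), hexp j' (a j - μ • e j v)]
      exact Finset.sum_congr rfl fun u hu => by
        rw [((ha j').2 u).mp hu, (hF'.2 u).mp hu]
    rw [h2, LinearMap.sub_apply, LinearMap.smul_apply, smul_eq_mul] at h1
    have := mul_neg_of_pos_of_neg hμ hneg
    linarith
  · obtain ⟨F', hF'⟩ := S.exists_isFace_of_le (a := -a i) (fun u => by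
      have := (ha i).1 (S.neg u)
      rwa [S.c_neg, map_neg] at this)
    have hmem : ∀ v, v ∈ F' ↔ S.neg v ∈ i.1 := by
      intro v
      rw [hF'.2, (ha i).2, S.c_neg, map_neg, LinearMap.neg_apply]
    refine ⟨⟨F', _, hF', ?_⟩, hmem⟩
    rw [← hcard i]
    refine Finset.card_nbij' S.neg S.neg (fun v hv => (hmem v).mp hv) (fun v hv => ?_)
      (fun v _ => S.neg_neg v) (fun v _ => S.neg_neg v)
    exact (hmem _).mpr (by rwa [S.neg_neg])
  · have h1 := ((ha i).2 v).mp hv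
    have h2 := ((ha i).2 _).mp hv'
    rw [S.c_neg, map_neg, h1] at h2
    norm_num at h2

theorem three_pow_le_card [Fintype V] [DecidableEq V] (hd : 0 < d) (𝒢 : Finset (Finset V))
    (h𝒢 : ∀ a G, S.IsFace a G → G ∈ 𝒢) : 3 ^ d ≤ 𝒢.card := by
  classical
  obtain ⟨a, F, hF⟩ := S.exists_facet
  obtain ⟨T, hT⟩ := S.exists_symmetricShelledFan
  have : Nonempty {F : Finset V // ∃ a, S.IsFace a F ∧ F.card = d} := ⟨⟨F, a, hF⟩⟩
  refine T.three_pow_le_card hd 𝒢 fun i G hG => ?_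
  rw [hT] at hG
  obtain ⟨a, ha, hc⟩ := i.2
  obtain ⟨l, hl⟩ := ha.exists_of_subset hc hG
  exact h𝒢 l G hl

end SymmetricSimplicialConfiguration

section Polytope

variable {d : ℕ} {P : Set (Fin d → ℝ)}

theorem IsPolytope.isCompact (hP : IsPolytope P) : IsCompact P := by
  obtain ⟨W, rfl⟩ := hP
  exact W.finite_toSet.isCompact_convexHull ℝ

theorem IsPolytope.convex (hP : IsPolytope P) : Convex ℝ P := by
  obtain ⟨W, rfl⟩ := hP
  exact convex_convexHull ℝ _

theorem IsPolytope.finite_extremePoints (hP : IsPolytope P) : (P.extremePoints ℝ).Finite := by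
  obtain ⟨W, rfl⟩ := hP
  exact W.finite_toSet.subset extremePoints_convexHull_subset

theorem IsPolytope.convexHull_extremePoints (hP : IsPolytope P) :
    convexHull ℝ (P.extremePoints ℝ) = P := by
  rw [← (hP.finite_extremePoints.isClosed_convexHull ℝ).closure_eq]
  exact closure_convexHull_extremePoints hP.isCompact hP.convex

theorem IsExposed.closure_convexHull_inter_extremePoints {X : Set (Fin d → ℝ)}
    (hX : IsExposed ℝ P X) (hP : IsPolytope P) :
    closure (convexHull ℝ (X ∩ P.extremePoints ℝ)) = X := by
  rw [← hX.isExtreme.extremePoints_eq]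
  exact closure_convexHull_extremePoints (hX.isCompact hP.isCompact) (hX.convex hP.convex)

theorem IsPolytope.finite_setOf_isProperFace (hP : IsPolytope P) :
    {X | IsProperFace P X}.Finite := by
  refine Set.Finite.of_finite_image (f := fun X => X ∩ P.extremePoints ℝ)
    (hP.finite_extremePoints.powerset.subset ?_) fun X hX Y hY h => ?_
  · rintro _ ⟨X, -, rfl⟩
    exact inter_subset_right
  · rw [← hX.2.2.closure_convexHull_inter_extremePoints hP,
      ← hY.2.2.closure_convexHull_inter_extremePoints hP]
    exact congrArg (fun Z => closure (convexHull ℝ Z)) h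

theorem IsPolytope.apply_le_one (hP : IsPolytope P) {a : Module.Dual ℝ (Fin d → ℝ)}
    (ha : ∀ v ∈ P.extremePoints ℝ, a v ≤ 1) {x : Fin d → ℝ} (hx : x ∈ P) : a x ≤ 1 := by
  rw [← hP.convexHull_extremePoints] at hx
  exact convexHull_min (t := {x | a x ≤ 1}) ha (convex_halfSpace_le a.isLinear 1) hx

theorem isProperFace_of_apply_le_one (hsym : P = -P) {a : Module.Dual ℝ (Fin d → ℝ)}
    (ha : ∀ x ∈ P, a x ≤ 1) (hne : {x ∈ P | a x = 1}.Nonempty) :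
    IsProperFace P {x ∈ P | a x = 1} := by
  obtain ⟨v, hv, hv1⟩ := hne
  refine ⟨⟨v, hv, hv1⟩, fun h => ?_, fun _ => ⟨a.toContinuousLinearMap, ?_⟩⟩
  · have h1 : -v ∈ P := by rw [hsym]; simpa using hv
    rw [← h] at h1
    have h2 := h1.2
    rw [map_neg, hv1] at h2
    norm_num at h2
  · ext x
    simp only [mem_ofPred_eq, LinearMap.coe_toContinuousLinearMap']
    refine and_congr_right fun hx => ⟨fun h y hy => h ▸ ha y hy, fun h => ?_⟩
    exact le_antisymm (ha x hx) (hv1 ▸ h v hv)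

theorem finrank_direction_lt {a : Module.Dual ℝ (Fin d → ℝ)}
    (hne : {x ∈ P | a x = 1}.Nonempty) :
    Module.finrank ℝ (affineSpan ℝ {x ∈ P | a x = 1}).direction < d := by
  obtain ⟨v, hv, hv1⟩ := hne
  have hle : (affineSpan ℝ {x ∈ P | a x = 1}).direction ≤ LinearMap.ker a := by
    rw [direction_affineSpan, vectorSpan_def, Submodule.span_le]
    rintro _ ⟨x, hx, y, hy, rfl⟩
    simp [hx.2, hy.2]
  have hker : LinearMap.ker a ≠ ⊤ := by
    intro h
    have : v ∈ LinearMap.ker a := h ▸ Submodule.mem_top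
    rw [LinearMap.mem_ker, hv1] at this
    norm_num at this
  calc _ ≤ Module.finrank ℝ (LinearMap.ker a) := Submodule.finrank_mono hle
    _ < d := by simpa using Submodule.finrank_lt hker

theorem neg_mem_extremePoints (hsym : P = -P) {v : Fin d → ℝ} (hv : v ∈ P.extremePoints ℝ) :
    -v ∈ P.extremePoints ℝ := by
  have hneg : ∀ x ∈ P, -x ∈ P := fun x hx => by rw [hsym]; simpa using hx
  refine ⟨hneg v hv.1, fun x hx y hy hxy => ?_⟩
  have := hv.2 (hneg x hx) (hneg y hy) (by
    obtain ⟨s, t, hs, ht, hst, h⟩ := hxy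
    exact ⟨s, t, hs, ht, hst, by rw [smul_neg, smul_neg, ← neg_add, h, neg_neg]⟩)
  exact neg_eq_iff_eq_neg.mp this

/-- The configuration of the vertices of a centrally symmetric simplicial polytope. -/
noncomputable def vertexConfiguration (hpoly : IsPolytope P) (hsym : P = -P)
    (hfull : affineSpan ℝ P = ⊤) (hsimp : IsSimplicial P) :
    SymmetricSimplicialConfiguration d (P.extremePoints ℝ) where
  c := Subtype.val
  neg v := ⟨-v.1, neg_mem_extremePoints hsym v.2⟩
  neg_neg v := Subtype.ext (neg_neg v.1)
  c_neg _ := rfl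
  span_eq_top := by
    rw [Subtype.range_coe_subtype, ofPred_mem_eq, eq_top_iff]
    intro x _
    have hx : x ∈ affineSpan ℝ (P.extremePoints ℝ) := by
      rw [← affineSpan_convexHull, hpoly.convexHull_extremePoints, hfull]
      exact AffineSubspace.mem_top ℝ _ x
    exact affineSpan_subset_span hx
  linearIndependent a ha := by
    have ha' : ∀ x ∈ P, a x ≤ 1 := fun x hx => hpoly.apply_le_one (fun v hv => ha ⟨v, hv⟩) hx
    rw [linearIndependent_iff']
    intro s g hg i hi
    have hX := isProperFace_of_apply_le_one hsym ha' ⟨i.1, i.1.2.1, i.2⟩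
    have hext := hX.2.2.isExtreme.extremePoints_eq
    have hind := hsimp _ hX
    have hind' := hind.comp_embedding (⟨fun v => ⟨v.1.1, by
      rw [hext]; exact ⟨⟨v.1.2.1, v.2⟩, v.1.2⟩⟩, fun u v huv =>
        Subtype.ext (Subtype.ext (congrArg (fun x => x.1) huv))⟩ :
      {v : P.extremePoints ℝ // a v = 1} ↪ {x ∈ P | a x = 1}.extremePoints ℝ)
    rw [affineIndependent_iff] at hind'
    refine hind' s g ?_ hg i hi
    have := congrArg a hg
    rw [map_sum, map_zero] at this
    rw [← this]
    exact Finset.sum_congr rfl fun v _ => by rw [map_smul, v.2, smul_eq_mul, mul_one]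

theorem IsPolytope.sum_faceCount (hP : IsPolytope P) (n : ℕ) :
    ∑ j ∈ Finset.range n, faceCount P j = {X | IsProperFace P X ∧
      Module.finrank ℝ (affineSpan ℝ X).direction < n}.ncard := by
  classical
  have hfin : {X | IsProperFace P X ∧
      Module.finrank ℝ (affineSpan ℝ X).direction < n}.Finite :=
    hP.finite_setOf_isProperFace.subset fun _ h => h.1
  rw [Set.ncard_eq_toFinset_card _ hfin, Finset.card_eq_sum_card_fiberwise
    (f := fun X => Module.finrank ℝ (affineSpan ℝ X).direction) (t := Finset.range n)
    (fun X hX => by simpa using ((hfin.mem_toFinset).mp hX).2)]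
  refine Finset.sum_congr rfl fun j hj => ?_
  rw [faceCount, ← Set.ncard_coe_finset]
  congr 1
  ext X
  rw [Finset.mem_range] at hj
  simp only [Finset.coe_filter, Set.Finite.mem_toFinset, mem_ofPred_eq]
  refine ⟨fun h => ⟨⟨h.1, h.2.trans_lt hj⟩, h.2⟩, fun h => ⟨h.1.1, h.2⟩⟩

end Polytope

/-- Kalai's 3^d conjecture for centrally symmetric simplicial `d`-polytopes:
the total number of faces (including the empty face, excluding `P` itself)
is at least `3^d`. -/
theorem stmt18 {d : ℕ} (P : Set (Fin d → ℝ))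
    (hpoly : IsPolytope P) (hsym : P = -P) (hfull : affineSpan ℝ P = ⊤)
    (hsimp : IsSimplicial P) :
    3 ^ d ≤ 1 + ∑ j ∈ Finset.range d, faceCount P j := by
  classical
  rcases Nat.eq_zero_or_pos d with rfl | hd
  · simp
  have := hpoly.finite_extremePoints.fintype
  set S := vertexConfiguration hpoly hsym hfull hsimp with hS
  set 𝒢 : Finset (Finset (P.extremePoints ℝ)) :=
    Finset.univ.filter fun G => ∃ a, S.IsFace a G with h𝒢
  have h1 : 3 ^ d ≤ 𝒢.card := S.three_pow_le_card hd 𝒢 fun a G h => by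
    simpa [h𝒢] using ⟨a, h⟩
  have h2 : (𝒢.erase ∅).card ≤ ∑ j ∈ Finset.range d, faceCount P j := by
    rw [hpoly.sum_faceCount, Set.ncard_eq_toFinset_card _
      (hpoly.finite_setOf_isProperFace.subset fun _ h => h.1)]
    have hmem : ∀ G ∈ 𝒢.erase ∅, ∃ a, S.IsFace a G := fun G hG => by
      simpa [h𝒢] using Finset.mem_of_mem_erase hG
    choose! a ha using hmem
    have hiff : ∀ G ∈ 𝒢.erase ∅, ∀ v : P.extremePoints ℝ,
        v ∈ G ↔ v.1 ∈ {x ∈ P | a G x = 1} := fun G hG v =>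
      ((ha G hG).2 v).trans ⟨fun h => ⟨v.2.1, h⟩, fun h => h.2⟩
    refine Finset.card_le_card_of_injOn (fun G => {x ∈ P | a G x = 1}) (fun G hG => ?_)
      fun G hG G' hG' h => ?_
    · obtain ⟨v, hv⟩ := Finset.nonempty_iff_ne_empty.mpr (Finset.ne_of_mem_erase hG)
      have hne : {x ∈ P | a G x = 1}.Nonempty := ⟨v.1, (hiff G hG v).mp hv⟩
      rw [Finset.mem_coe, Set.Finite.mem_toFinset]
      exact ⟨isProperFace_of_apply_le_one hsym (fun x hx =>
        hpoly.apply_le_one (fun v hv => (ha G hG).1 ⟨v, hv⟩) hx) hne, finrank_direction_lt hne⟩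
    · ext v
      rw [hiff G hG, hiff G' hG']
      exact iff_of_eq (congrArg (fun X => v.1 ∈ X) h)
  have h3 := Finset.pred_card_le_card_erase (s := 𝒢) (a := ∅)
  omega
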